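/- Let g(λ₁,λ₂,λ₃) = (3/2)·(λ₁+λ₂+λ₃)³·(λ₁−λ₂)·(λ₁−λ₃)·(λ₂−λ₃) for a triple of natural numbers. For a natural number m, let S(m) be the sum of g(λ₁,λ₂,λ₃) over all pairs (γ,(λ₁,λ₂,λ₃)) of a natural number γ with 0 ≤ γ ≤ m/5 and a triple of natural numbers satisfying λ₁ + 2λ₂ + 3λ₃ = m − γ, λ₁ − λ₂ ≥ γ, λ₂ − λ₃ ≥ γ and λ₁ − λ₃ ≥ γ. Then S(m) is asymptotically equivalent to (49403/2520000000)·m⁹ as m → ∞; that is, S(m)/m⁹ converges to 49403/2520000000 as m tends to infinity. -/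

import Mathlib

open Filter

/-- The weight `g(λ₁,λ₂,λ₃) = (3/2)·(λ₁+λ₂+λ₃)³·(λ₁−λ₂)·(λ₁−λ₃)·(λ₂−λ₃)`. -/
noncomputable def jetWeight (a b c : ℕ) : ℚ :=
  (3 / 2) * ((a : ℚ) + b + c) ^ 3 * ((a : ℚ) - b) * ((a : ℚ) - c) * ((b : ℚ) - c)

/-- The sum `S(m)` of `g(λ₁,λ₂,λ₃)` over all `0 ≤ γ ≤ m/5` and triples of naturals with
`λ₁ + 2λ₂ + 3λ₃ = m − γ`, `λ₁ − λ₂ ≥ γ`, `λ₂ − λ₃ ≥ γ`, `λ₁ − λ₃ ≥ γ`. -/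
noncomputable def jetSum (m : ℕ) : ℚ :=
  ∑ γ ∈ Finset.range (m / 5 + 1),
    ∑ t ∈ (Finset.range (m + 1) ×ˢ Finset.range (m + 1) ×ˢ Finset.range (m + 1)).filter
      (fun t => t.1 + 2 * t.2.1 + 3 * t.2.2 = m - γ ∧
        t.2.1 + γ ≤ t.1 ∧ t.2.2 + γ ≤ t.2.1 ∧ t.2.2 + γ ≤ t.1),
      jetWeight t.1 t.2.1 t.2.2

/-- The convolution `m ↦ ∑_{d q ≤ m} q ^ j * f (m - d q)`. -/
noncomputable def powConv (d j : ℕ) (f : ℕ → ℝ) (m : ℕ) : ℝ :=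
  ∑ q ∈ Finset.range (m / d + 1), (q : ℝ) ^ j * f (m - d * q)

/-- `f n = A n ^ p + O(n ^ (p - 1))`, with no error term if `p = 0`. -/
def PowAsymp (f : ℕ → ℝ) (A : ℝ) (p : ℕ) : Prop :=
  ∃ C : ℝ, 0 ≤ C ∧ ∀ n : ℕ, |f n - A * (n : ℝ) ^ p| ≤ C * p * ((n : ℝ) + 1) ^ (p - 1)

/-- The leading coefficient of `m ↦ ∑_{d q ≤ m} q ^ j * (m - d q) ^ p`. -/
noncomputable def betaCoeff (d j p : ℕ) : ℝ :=
  (j.factorial * p.factorial : ℝ) / ((d : ℝ) ^ (j + 1) * ((j + p + 1).factorial : ℝ))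

lemma PowAsymp.of_bound {f : ℕ → ℝ} {A C : ℝ} {p : ℕ} (hC : 0 ≤ C)
    (h : ∀ n : ℕ, |f n - A * (n : ℝ) ^ (p + 1)| ≤ C * ((n : ℝ) + 1) ^ p) :
    PowAsymp f A (p + 1) := by
  refine ⟨C, hC, fun n => (h n).trans ?_⟩
  have h1 : (1 : ℝ) ≤ ((p + 1 : ℕ) : ℝ) := by push_cast; linarith [Nat.cast_nonneg (α := ℝ) p]
  have h2 : C ≤ C * ((p + 1 : ℕ) : ℝ) := le_mul_of_one_le_right hC h1
  exact mul_le_mul_of_nonneg_right h2 (by positivity)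

lemma powAsymp_pow (p : ℕ) : PowAsymp (fun n => (n : ℝ) ^ p) 1 p :=
  ⟨0, le_rfl, fun n => by simp⟩

lemma PowAsymp.exists_bound {f : ℕ → ℝ} {A : ℝ} {p : ℕ} (h : PowAsymp f A (p + 1)) :
    ∃ C : ℝ, 0 ≤ C ∧ ∀ n : ℕ, |f n - A * (n : ℝ) ^ (p + 1)| ≤ C * ((n : ℝ) + 1) ^ p := by
  obtain ⟨C, hC, h⟩ := h
  exact ⟨C * (p + 1 : ℕ), by positivity, h⟩

lemma PowAsymp.tendsto {f : ℕ → ℝ} {A : ℝ} {p : ℕ} (h : PowAsymp f A (p + 1)) :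
    Tendsto (fun n : ℕ => f n / (n : ℝ) ^ (p + 1)) atTop (nhds A) := by
  obtain ⟨C, hC, h⟩ := h.exists_bound
  rw [tendsto_iff_norm_sub_tendsto_zero]
  refine squeeze_zero' (Eventually.of_forall fun n => norm_nonneg _) ?_
    (tendsto_const_div_atTop_nhds_zero_nat (C * 2 ^ p))
  filter_upwards [eventually_ge_atTop 1] with n hn
  have hn' : (1 : ℝ) ≤ n := by exact_mod_cast hn
  have hpos : (0 : ℝ) < n := by linarith
  have h2 : ((n : ℝ) + 1) ^ p ≤ 2 ^ p * (n : ℝ) ^ p := by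
    rw [← mul_pow]
    exact pow_le_pow_left₀ (by positivity) (by linarith) p
  have h3 : f n / (n : ℝ) ^ (p + 1) - A = (f n - A * (n : ℝ) ^ (p + 1)) / (n : ℝ) ^ (p + 1) := by
    field_simp
  rw [h3, Real.norm_eq_abs, abs_div, abs_of_pos (pow_pos hpos (p + 1)),
    div_le_div_iff₀ (pow_pos hpos _) hpos]
  calc |f n - A * (n : ℝ) ^ (p + 1)| * n ≤ (C * (2 ^ p * (n : ℝ) ^ p)) * n := by
        gcongr
        exact (h n).trans (by gcongr)
    _ = C * 2 ^ p * (n : ℝ) ^ (p + 1) := by ring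

lemma succ_pow_sub_pow_bounds {x : ℝ} (hx : 0 ≤ x) (j : ℕ) :
    (j + 1) * x ^ j ≤ (x + 1) ^ (j + 1) - x ^ (j + 1) ∧
      (x + 1) ^ (j + 1) - x ^ (j + 1) ≤ (j + 1) * (x + 1) ^ j := by
  induction j with
  | zero => simp
  | succ j ih =>
    have hle : x ^ (j + 1) ≤ (x + 1) ^ (j + 1) := pow_le_pow_left₀ hx (by linarith) _
    have e : (x + 1) ^ (j + 1 + 1) - x ^ (j + 1 + 1) =
        x * ((x + 1) ^ (j + 1) - x ^ (j + 1)) + (x + 1) ^ (j + 1) := by ring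
    have e' : (x + 1) ^ (j + 1 + 1) - x ^ (j + 1 + 1) =
        (x + 1) * ((x + 1) ^ (j + 1) - x ^ (j + 1)) + x ^ (j + 1) := by ring
    push_cast
    constructor
    · rw [e]
      have := mul_le_mul_of_nonneg_left ih.1 hx
      have e2 : x * ((j + 1) * x ^ j) = (j + 1) * x ^ (j + 1) := by ring
      linarith
    · rw [e']
      have := mul_le_mul_of_nonneg_left ih.2 (by linarith : (0 : ℝ) ≤ x + 1)
      have e2 : (x + 1) * ((j + 1) * (x + 1) ^ j) = (j + 1) * (x + 1) ^ (j + 1) := by ring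
      linarith

lemma sum_range_succ_pow_bounds (j M : ℕ) :
    (M : ℝ) ^ (j + 1) ≤ (j + 1) * ∑ q ∈ Finset.range (M + 1), (q : ℝ) ^ j ∧
      (j + 1) * ∑ q ∈ Finset.range (M + 1), (q : ℝ) ^ j ≤ ((M : ℝ) + 1) ^ (j + 1) := by
  induction M with
  | zero =>
    rcases j with _ | j <;> simp
  | succ M ih =>
    rw [Finset.sum_range_succ, mul_add]
    have h1 := (succ_pow_sub_pow_bounds (Nat.cast_nonneg (α := ℝ) M) j).2
    have h2 := (succ_pow_sub_pow_bounds (Nat.cast_nonneg (α := ℝ) (M + 1)) j).1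
    push_cast at *
    constructor <;> linarith [ih.1, ih.2]

lemma powAsymp_powConv_one {d : ℕ} (hd : 0 < d) (j : ℕ) :
    PowAsymp (powConv d j fun n => (n : ℝ) ^ 0) (betaCoeff d j 0) (j + 1) := by
  refine PowAsymp.of_bound (C := 1) zero_le_one fun m => ?_
  have hd' : (0 : ℝ) < d := by exact_mod_cast hd
  set M := m / d with hM
  obtain ⟨h1, h2⟩ := sum_range_succ_pow_bounds j M
  have h3 := (succ_pow_sub_pow_bounds (Nat.cast_nonneg (α := ℝ) M) j).2
  have hMx : (M : ℝ) ≤ m / d := Nat.cast_div_le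
  have hxM : (m : ℝ) / d ≤ M + 1 := by
    rw [div_le_iff₀ hd']
    have : m ≤ (M + 1) * d := by
      rw [mul_comm]; exact (Nat.lt_mul_div_succ m hd).le
    exact_mod_cast this
  have hMm : (M : ℝ) ≤ m := by exact_mod_cast Nat.div_le_self m d
  have h4 : (M : ℝ) ^ (j + 1) ≤ ((m : ℝ) / d) ^ (j + 1) := by gcongr
  have h5 : ((m : ℝ) / d) ^ (j + 1) ≤ ((M : ℝ) + 1) ^ (j + 1) := by gcongr
  have h6 : ((M : ℝ) + 1) ^ j ≤ ((m : ℝ) + 1) ^ j := by gcongr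
  have hj : (0 : ℝ) < j + 1 := by positivity
  have hB : (j + 1) * (betaCoeff d j 0 * (m : ℝ) ^ (j + 1)) = ((m : ℝ) / d) ^ (j + 1) := by
    have := Nat.cast_ne_zero (R := ℝ).mpr j.factorial_ne_zero
    simp only [betaCoeff, add_zero, Nat.factorial_succ, Nat.factorial_zero]
    push_cast
    rw [div_pow]
    field_simp
  have hc : powConv d j (fun n => (n : ℝ) ^ 0) m = ∑ q ∈ Finset.range (M + 1), (q : ℝ) ^ j := by
    simp [powConv, hM]
  rw [hc]
  refine le_of_mul_le_mul_left ?_ hj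
  have h7 := mul_le_mul_of_nonneg_left h6 hj.le
  rw [← abs_of_pos hj, ← abs_mul, abs_of_pos hj, mul_sub, hB, abs_le]
  constructor <;> linarith

lemma powConv_pow_succ {d : ℕ} (j p m : ℕ) :
    powConv d j (fun n => (n : ℝ) ^ (p + 1)) m =
      m * powConv d j (fun n => (n : ℝ) ^ p) m -
        d * powConv d (j + 1) (fun n => (n : ℝ) ^ p) m := by
  simp only [powConv, Finset.mul_sum, ← Finset.sum_sub_distrib]
  refine Finset.sum_congr rfl fun q hq => ?_
  have hq' : d * q ≤ m :=
    (Nat.mul_le_mul_left d (Nat.lt_succ_iff.mp (Finset.mem_range.mp hq))).trans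
      (Nat.mul_div_le m d)
  rw [Nat.cast_sub hq']
  push_cast
  ring

lemma betaCoeff_succ {d : ℕ} (hd : 0 < d) (j p : ℕ) :
    betaCoeff d j (p + 1) = betaCoeff d j p - d * betaCoeff d (j + 1) p := by
  have hd' : (d : ℝ) ≠ 0 := by exact_mod_cast hd.ne'
  have h1 := Nat.cast_ne_zero (R := ℝ).mpr (j + p).factorial_ne_zero
  simp only [betaCoeff, show j + (p + 1) + 1 = j + p + 1 + 1 by ring,
    show j + 1 + p + 1 = j + p + 1 + 1 by ring, Nat.factorial_succ]
  push_cast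
  field_simp
  ring

lemma powAsymp_powConv_pow {d : ℕ} (hd : 0 < d) (j p : ℕ) :
    PowAsymp (powConv d j fun n => (n : ℝ) ^ p) (betaCoeff d j p) (j + p + 1) := by
  induction p generalizing j with
  | zero => exact powAsymp_powConv_one hd j
  | succ p ih =>
    obtain ⟨C, hC, h⟩ := (ih j).exists_bound
    obtain ⟨C', hC', h'⟩ := (ih (j + 1)).exists_bound
    refine PowAsymp.of_bound (C := C + d * C') (by positivity) fun m => ?_
    have hm := h m
    have hm' := h' m
    set F := powConv d j (fun n => (n : ℝ) ^ p) m
    set G := powConv d (j + 1) (fun n => (n : ℝ) ^ p) m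
    rw [powConv_pow_succ, betaCoeff_succ hd]
    calc _ = |m * (F - betaCoeff d j p * (m : ℝ) ^ (j + p + 1)) -
          d * (G - betaCoeff d (j + 1) p * (m : ℝ) ^ (j + 1 + p + 1))| := by
          congr 1; ring
      _ ≤ m * (C * ((m : ℝ) + 1) ^ (j + p)) + d * (C' * ((m : ℝ) + 1) ^ (j + 1 + p)) := by
          refine (abs_sub _ _).trans ?_
          rw [abs_mul, abs_mul, Nat.abs_cast, Nat.abs_cast]
          gcongr
      _ ≤ ((m : ℝ) + 1) * (C * ((m : ℝ) + 1) ^ (j + p)) +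
          d * (C' * ((m : ℝ) + 1) ^ (j + 1 + p)) := by
          gcongr
          linarith
      _ = (C + d * C') * ((m : ℝ) + 1) ^ (j + (p + 1)) := by ring

lemma PowAsymp.powConv {f : ℕ → ℝ} {A : ℝ} {p d : ℕ} (hf : PowAsymp f A p) (hd : 0 < d)
    (j : ℕ) : PowAsymp (powConv d j f) (A * betaCoeff d j p) (j + p + 1) := by
  obtain ⟨C, hC, h⟩ := hf
  obtain ⟨C', hC', h'⟩ := (powAsymp_powConv_pow hd j p).exists_bound
  refine PowAsymp.of_bound (C := C * p + |A| * C') (by positivity) fun m => ?_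
  set T := _root_.powConv d j (fun n => (n : ℝ) ^ p) m with hT
  have h1 : |_root_.powConv d j f m - A * T| ≤ C * p * ((m : ℝ) + 1) ^ (j + p) := by
    have hterm : ∀ q ∈ Finset.range (m / d + 1),
        |(q : ℝ) ^ j * f (m - d * q) - A * ((q : ℝ) ^ j * ((m - d * q : ℕ) : ℝ) ^ p)| ≤
          ((m : ℝ) + 1) ^ j * (C * p * ((m : ℝ) + 1) ^ (p - 1)) := by
      intro q hq
      have hqm : q ≤ m := (Nat.lt_succ_iff.mp (Finset.mem_range.mp hq)).trans (Nat.div_le_self m d)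
      have hqm' : (q : ℝ) ≤ m + 1 := by
        have : (q : ℝ) ≤ m := by exact_mod_cast hqm
        linarith
      have hsub : ((m - d * q : ℕ) : ℝ) ≤ m := by exact_mod_cast Nat.sub_le _ _
      rw [show (q : ℝ) ^ j * f (m - d * q) - A * ((q : ℝ) ^ j * ((m - d * q : ℕ) : ℝ) ^ p) =
        (q : ℝ) ^ j * (f (m - d * q) - A * ((m - d * q : ℕ) : ℝ) ^ p) by ring, abs_mul,
        abs_of_nonneg (by positivity : (0 : ℝ) ≤ (q : ℝ) ^ j)]
      have := h (m - d * q)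
      gcongr
      exact this.trans (by gcongr)
    rw [hT, _root_.powConv, _root_.powConv, Finset.mul_sum, ← Finset.sum_sub_distrib]
    refine (Finset.abs_sum_le_sum_abs _ _).trans ((Finset.sum_le_sum hterm).trans ?_)
    rw [Finset.sum_const, Finset.card_range, nsmul_eq_mul]
    have hcard : ((m / d + 1 : ℕ) : ℝ) ≤ (m : ℝ) + 1 := by
      exact_mod_cast Nat.succ_le_succ (Nat.div_le_self m d)
    rcases p with _ | p
    · simp
    · calc _ ≤ ((m : ℝ) + 1) *
            (((m : ℝ) + 1) ^ j * (C * (p + 1 : ℕ) * ((m : ℝ) + 1) ^ (p + 1 - 1))) := by gcongr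
        _ = _ := by rw [Nat.add_sub_cancel]; ring
  calc _ = |(_root_.powConv d j f m - A * T) +
        A * (T - betaCoeff d j p * (m : ℝ) ^ (j + p + 1))| := by
        congr 1; ring
    _ ≤ C * p * ((m : ℝ) + 1) ^ (j + p) + |A| * (C' * ((m : ℝ) + 1) ^ (j + p)) := by
        refine (abs_add_le _ _).trans ?_
        rw [abs_mul]
        gcongr
        exact h' m
    _ = _ := by ring

/-- The sum of `Q x y γ c` over the naturals with `x + 3 y + 5 γ + 6 c = m`. -/
noncomputable def simplexSum (Q : ℝ → ℝ → ℝ → ℝ → ℝ) (m : ℕ) : ℝ :=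
  ∑ c ∈ Finset.range (m / 6 + 1), ∑ γ ∈ Finset.range ((m - 6 * c) / 5 + 1),
    ∑ y ∈ Finset.range ((m - 6 * c - 5 * γ) / 3 + 1),
      Q ((m - 6 * c - 5 * γ - 3 * y : ℕ) : ℝ) y γ c

lemma simplexSum_monomial (a : ℝ) (i j k l m : ℕ) :
    simplexSum (fun x y γ c => a * (x ^ i * y ^ j * γ ^ k * c ^ l)) m =
      a * powConv 6 l (powConv 5 k (powConv 3 j fun n => (n : ℝ) ^ i)) m := by
  simp only [simplexSum, powConv, Finset.mul_sum]
  refine Finset.sum_congr rfl fun c _ => Finset.sum_congr rfl fun γ _ =>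
    Finset.sum_congr rfl fun y _ => ?_
  ring

/-- The limit of `m ↦ ∑ x ^ i * y ^ j * γ ^ k * c ^ l / m ^ (i + j + k + l + 3)`, summed over
`x + 3 y + 5 γ + 6 c = m`. -/
noncomputable def simplexCoeff (i j k l : ℕ) : ℝ :=
  betaCoeff 3 j i * betaCoeff 5 k (j + i + 1) * betaCoeff 6 l (k + (j + i + 1) + 1)

lemma simplexSum_monomial_tendsto (a : ℝ) {i j k l p : ℕ} (hp : i + j + k + l + 3 = p) :
    Tendsto (fun m : ℕ => simplexSum (fun x y γ c => a * (x ^ i * y ^ j * γ ^ k * c ^ l)) m /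
      (m : ℝ) ^ p) atTop (nhds (a * simplexCoeff i j k l)) := by
  have h := ((((powAsymp_pow i).powConv (d := 3) (by norm_num) j).powConv (d := 5)
    (by norm_num) k).powConv (d := 6) (by norm_num) l).tendsto.const_mul a
  rw [one_mul, show l + (k + (j + i + 1) + 1) + 1 = p by omega] at h
  simpa only [simplexSum_monomial, mul_div_assoc, simplexCoeff] using h

lemma simplexSum_add (P Q : ℝ → ℝ → ℝ → ℝ → ℝ) (m : ℕ) :
    simplexSum (fun x y γ c => P x y γ c + Q x y γ c) m = simplexSum P m + simplexSum Q m := by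
  simp only [simplexSum, Finset.sum_add_distrib]

lemma simplexSum_list_tendsto {p : ℕ} (L : List (ℕ × ℕ × ℕ × ℕ × ℕ))
    (hL : ∀ e ∈ L, e.1 + e.2.1 + e.2.2.1 + e.2.2.2.1 + 3 = p) :
    Tendsto (fun m : ℕ => simplexSum (fun x y γ c => (L.map fun e =>
        (e.2.2.2.2 : ℝ) * (x ^ e.1 * y ^ e.2.1 * γ ^ e.2.2.1 * c ^ e.2.2.2.1)).sum) m /
      (m : ℝ) ^ p) atTop
      (nhds (L.map fun e =>
        (e.2.2.2.2 : ℝ) * simplexCoeff e.1 e.2.1 e.2.2.1 e.2.2.2.1).sum) := by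
  induction L with
  | nil => simp [simplexSum]
  | cons e L ih =>
    have h1 := simplexSum_monomial_tendsto (e.2.2.2.2 : ℝ) (hL e List.mem_cons_self)
    have h2 := h1.add (ih fun e he => hL e (List.mem_cons_of_mem _ he))
    simpa only [List.map_cons, List.sum_cons, simplexSum_add, add_div] using h2

/-- The monomials `(i, j, k, l)` and coefficients of the expansion of
`(x + 2y + 3γ + 3c)³ (x + γ) (x + y + 2γ) (y + γ)`. -/
def weightExpansion : List (ℕ × ℕ × ℕ × ℕ × ℕ) :=
  [(5, 1, 0, 0, 1), (5, 0, 1, 0, 1), (4, 2, 0, 0, 7), (4, 1, 1, 0, 19),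
    (4, 1, 0, 1, 9), (4, 0, 2, 0, 12), (4, 0, 1, 1, 9), (3, 3, 0, 0, 18),
    (3, 2, 1, 0, 82), (3, 2, 0, 1, 45), (3, 1, 2, 0, 120), (3, 1, 1, 1, 126),
    (3, 1, 0, 2, 27), (3, 0, 3, 0, 56), (3, 0, 2, 1, 81), (3, 0, 1, 2, 27),
    (2, 4, 0, 0, 20), (2, 3, 1, 0, 134), (2, 3, 0, 1, 72), (2, 2, 2, 0, 324),
    (2, 2, 1, 1, 351), (2, 2, 0, 2, 81), (2, 1, 3, 0, 336), (2, 1, 2, 1, 540),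
    (2, 1, 1, 2, 243), (2, 1, 0, 3, 27), (2, 0, 4, 0, 126), (2, 0, 3, 1, 261),
    (2, 0, 2, 2, 162), (2, 0, 1, 3, 27), (1, 5, 0, 0, 8), (1, 4, 1, 0, 80),
    (1, 4, 0, 1, 36), (1, 3, 2, 0, 294), (1, 3, 1, 1, 288), (1, 3, 0, 2, 54),
    (1, 2, 3, 0, 510), (1, 2, 2, 1, 783), (1, 2, 1, 2, 324), (1, 2, 0, 3, 27),
    (1, 1, 4, 0, 423), (1, 1, 3, 1, 882), (1, 1, 2, 2, 567), (1, 1, 1, 3, 108),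
    (1, 0, 5, 0, 135), (1, 0, 4, 1, 351), (1, 0, 3, 2, 297), (1, 0, 2, 3, 81),
    (0, 5, 1, 0, 8), (0, 4, 2, 0, 60), (0, 4, 1, 1, 36), (0, 3, 3, 0, 178),
    (0, 3, 2, 1, 216), (0, 3, 1, 2, 54), (0, 2, 4, 0, 261), (0, 2, 3, 1, 477),
    (0, 2, 2, 2, 243), (0, 2, 1, 3, 27), (0, 1, 5, 0, 189), (0, 1, 4, 1, 459),
    (0, 1, 3, 2, 351), (0, 1, 2, 3, 81), (0, 0, 6, 0, 54), (0, 0, 5, 1, 162),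
    (0, 0, 4, 2, 162), (0, 0, 3, 3, 54)]

lemma weightExpansion_sum (x y γ c : ℝ) :
    (weightExpansion.map fun e =>
      (e.2.2.2.2 : ℝ) * (x ^ e.1 * y ^ e.2.1 * γ ^ e.2.2.1 * c ^ e.2.2.2.1)).sum =
      (x + 2 * y + 3 * γ + 3 * c) ^ 3 * (x + γ) * (x + y + 2 * γ) * (y + γ) := by
  simp only [weightExpansion, List.map_cons, List.map_nil, List.sum_cons, List.sum_nil]
  push_cast
  ring

lemma weightExpansion_coeff_sum :
    (weightExpansion.map fun e =>
      (e.2.2.2.2 : ℝ) * simplexCoeff e.1 e.2.1 e.2.2.1 e.2.2.2.1).sum =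
      2 / 3 * (49403 / 2520000000) := by
  simp only [weightExpansion, List.map_cons, List.map_nil, List.sum_cons, List.sum_nil,
    simplexCoeff, betaCoeff]
  norm_num [Nat.factorial]

lemma jetSum_eq_simplexSum (m : ℕ) :
    (jetSum m : ℝ) = 3 / 2 * simplexSum (fun x y γ c =>
      (x + 2 * y + 3 * γ + 3 * c) ^ 3 * (x + γ) * (x + y + 2 * γ) * (y + γ)) m := by
  simp only [jetSum, simplexSum, Rat.cast_sum, Finset.mul_sum, Finset.sum_sigma']
  refine Finset.sum_bij'
    (fun s _ => ⟨s.2.2.2, s.1, s.2.2.1 - s.2.2.2 - s.1⟩)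
    (fun s _ => ⟨s.2.1, (s.1 + 2 * s.2.1 + s.2.2 + (m - 6 * s.1 - 5 * s.2.1 - 3 * s.2.2),
      s.1 + s.2.1 + s.2.2, s.1)⟩) ?_ ?_ ?_ ?_ ?_
  · rintro ⟨γ, a, b, c⟩ h
    simp only [Finset.mem_sigma, Finset.mem_filter, Finset.mem_product, Finset.mem_range] at h ⊢
    omega
  · rintro ⟨c, γ, y⟩ h
    simp only [Finset.mem_sigma, Finset.mem_filter, Finset.mem_product, Finset.mem_range] at h ⊢
    omega
  · rintro ⟨γ, a, b, c⟩ h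
    simp only [Finset.mem_sigma, Finset.mem_filter, Finset.mem_product, Finset.mem_range] at h
    simp only [Sigma.mk.injEq, heq_eq_eq, Prod.mk.injEq, true_and, and_true]
    omega
  · rintro ⟨c, γ, y⟩ h
    simp only [Sigma.mk.injEq, heq_eq_eq, true_and]
    omega
  · rintro ⟨γ, a, b, c⟩ h
    simp only [Finset.mem_sigma, Finset.mem_filter, Finset.mem_product, Finset.mem_range] at h
    obtain ⟨y, rfl⟩ : ∃ y, b = c + γ + y := ⟨b - c - γ, by omega⟩
    obtain ⟨x, rfl⟩ : ∃ x, a = c + 2 * γ + y + x := ⟨a - (c + 2 * γ + y), by omega⟩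
    simp only [show c + γ + y - c - γ = y by omega,
      show m - 6 * c - 5 * γ - 3 * y = x by omega, jetWeight]
    push_cast
    ring

theorem jetSum_asymptotic :
    Tendsto (fun m : ℕ => (jetSum m : ℝ) / (m : ℝ) ^ 9) atTop
      (nhds (49403 / 2520000000)) := by
  have h := (simplexSum_list_tendsto (p := 9) weightExpansion (by decide)).const_mul (3 / 2)
  simp only [weightExpansion_sum, weightExpansion_coeff_sum] at h
  convert h using 2 with m
  · rw [jetSum_eq_simplexSum, mul_div_assoc]
  · norm_num
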